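/- arXiv:1907.12948 — 2 statements merged into one kernel-verified Lean document; each statement's English description precedes it below -/
import Mathlib

section
/- Let B = (β_{ij}) and C = (γ_{ij}) be n×n matrices over 𝔼 that coincide in every row except possibly row k: β_{ij} = γ_{ij} = α_{ij} for all i ≠ k and all j. Let A = (α_{ij}) be the n×n matrix with α_{ij} as above for i ≠ k and α_{kj} = β_{kj} + γ_{kj} for all j. Then det(A) ⊆ det(B) + det(C). Moreover, if max_{i≠k, 1≤j≤n} R(α_{ij}) ≤ max{min_{1≤j≤n} R(β_{kj}), min_{1≤j≤n} R(γ_{kj})}, or if β_{kj} and γ_{kj} are not nearly opposite for every j, then det(A) = det(B) + det(C). -/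
open scoped Pointwise Classical

noncomputable section

-- Note: `ℝ*` is Mathlib's notation for the hyperreals `Hyperreal`.

/-- A neutrix: an order-convex additive subgroup of the hyperreals. -/
def IsNeutrix (A : Set ℝ*) : Prop :=
  (0 : ℝ*) ∈ A ∧ (∀ x ∈ A, ∀ y ∈ A, x + y ∈ A) ∧ (∀ x ∈ A, -x ∈ A) ∧
    ∀ x ∈ A, ∀ y ∈ A, ∀ z : ℝ*, x ≤ z → z ≤ y → z ∈ A

/-- The coset `a + A`. -/
def coset (a : ℝ*) (A : Set ℝ*) : Set ℝ* := {x | ∃ u ∈ A, x = a + u}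

/-- `α` is an external number: a coset of a neutrix. -/
def IsExt (α : Set ℝ*) : Prop := ∃ a A, IsNeutrix A ∧ α = coset a A

/-- The neutrix part `N(α)` of an external number, as the set of differences. -/
def Nx (α : Set ℝ*) : Set ℝ* := {d | ∃ x ∈ α, ∃ y ∈ α, d = x - y}

/-- An external number is zeroless if it does not contain `0`. -/
def Zeroless (α : Set ℝ*) : Prop := (0 : ℝ*) ∉ α

/-- Multiplication of external numbers: `αβ = ab + aB + bA + AB`
(independent of the chosen representatives). -/
def emul (α β : Set ℝ*) : Set ℝ* :=
  {z | ∃ a A b B, IsNeutrix A ∧ IsNeutrix B ∧ α = coset a A ∧ β = coset b B ∧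
      ∃ u ∈ A, ∃ v ∈ B, ∃ u' ∈ A, ∃ v' ∈ B, z = a * b + a * v + b * u + u' * v'}

/-- Multiplication of an external number by a hyperreal scalar: `t·α = ta + tA`. -/
def esmul (t : ℝ*) (α : Set ℝ*) : Set ℝ* := (fun x => t * x) '' α

/-- Inverse of a (zeroless) external number: `1/α = 1/a + A/a²`. -/
def einv (α : Set ℝ*) : Set ℝ* :=
  {z | ∃ a A, IsNeutrix A ∧ α = coset a A ∧ ∃ u ∈ A, z = a⁻¹ + u / a ^ 2}

/-- Division of external numbers: `α/β = α · (1/β)`. -/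
def ediv (α β : Set ℝ*) : Set ℝ* := emul α (einv β)

/-- The neutrix `⊘` of infinitesimal hyperreals. -/
def oslash : Set ℝ* := {x | Hyperreal.Infinitesimal x}

/-- Relative uncertainty `R(α)`: `A/a` if `α = a + A` is zeroless,
and all of `ℝ*` if `α` is a neutrix. -/
def RU (α : Set ℝ*) : Set ℝ* :=
  if (0 : ℝ*) ∈ α then Set.univ
  else {z | ∃ a A, IsNeutrix A ∧ α = coset a A ∧ ∃ u ∈ A, z = u / a}

/-- `α` and `β` are nearly opposite: both zeroless and `α/β ⊆ -1 + ⊘`. -/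
def NearlyOpposite (α β : Set ℝ*) : Prop :=
  Zeroless α ∧ Zeroless β ∧ ediv α β ⊆ coset (-1) oslash

/-- Order on external numbers: `α ≤ β` iff `∀ x ∈ α, ∃ y ∈ β, x ≤ y`. -/
def ele (α β : Set ℝ*) : Prop := ∀ x ∈ α, ∃ y ∈ β, x ≤ y

/-- `α` is non-negative: some element of `α` is `≥ 0`. -/
def eNonneg (α : Set ℝ*) : Prop := ∃ x ∈ α, (0 : ℝ*) ≤ x

/-- Absolute value of an external number: `|α| = |a| + A`. -/
def eabs (α : Set ℝ*) : Set ℝ* :=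
  {z | ∃ a A, IsNeutrix A ∧ α = coset a A ∧ ∃ u ∈ A, z = |a| + u}

/-- Product of a finite family of external numbers. -/
def eprod : ∀ {n : ℕ}, (Fin n → Set ℝ*) → Set ℝ*
  | 0, _ => {1}
  | _ + 1, f => emul (f 0) (eprod fun i => f i.succ)

/-- Power of an external number. -/
def epow (α : Set ℝ*) : ℕ → Set ℝ*
  | 0 => {1}
  | k + 1 => emul α (epow α k)

/-- Matrix product over external numbers: `(AB)_{ij} = Σ_k α_{ik}β_{kj}`. -/
def matMul {m n p : ℕ} (M : Matrix (Fin m) (Fin n) (Set ℝ*))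
    (N : Matrix (Fin n) (Fin p) (Set ℝ*)) : Matrix (Fin m) (Fin p) (Set ℝ*) :=
  fun i j => ∑ k, emul (M i k) (N k j)

/-- Entrywise (Minkowski) sum of matrices over external numbers. -/
def matAdd {m n : ℕ} (M N : Matrix (Fin m) (Fin n) (Set ℝ*)) :
    Matrix (Fin m) (Fin n) (Set ℝ*) := fun i j => M i j + N i j

/-- Entrywise scalar multiple of a matrix by an external number. -/
def matSmul {m n : ℕ} (α : Set ℝ*) (M : Matrix (Fin m) (Fin n) (Set ℝ*)) :
    Matrix (Fin m) (Fin n) (Set ℝ*) := fun i j => emul α (M i j)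

/-- Entrywise inclusion of matrices over external numbers. -/
def matIncl {m n : ℕ} (M N : Matrix (Fin m) (Fin n) (Set ℝ*)) : Prop :=
  ∀ i j, M i j ⊆ N i j

/-- Determinant of a square matrix over the external numbers. -/
def detE {n : ℕ} (M : Matrix (Fin n) (Fin n) (Set ℝ*)) : Set ℝ* :=
  ∑ σ : Equiv.Perm (Fin n),
    esmul ((Equiv.Perm.sign σ : ℤ) : ℝ*) (eprod fun i => M i (σ i))

/-- The `(i,j)` minor of a square matrix over the external numbers. -/
def minorE {n : ℕ} (M : Matrix (Fin (n + 1)) (Fin (n + 1)) (Set ℝ*))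
    (i j : Fin (n + 1)) : Set ℝ* :=
  detE (M.submatrix i.succAbove j.succAbove)

/-- The near-identity matrix `I_n(N)`: diagonal entries `1 + N`, off-diagonal entries `N`. -/
def Iun (n : ℕ) (N : Set ℝ*) : Matrix (Fin n) (Fin n) (Set ℝ*) :=
  fun i j => if i = j then coset 1 N else N

/-- A finite family of vectors of external numbers is linearly dependent:
some nontrivial real (hyperreal) linear combination is a neutrix vector. -/
def LinDepE {ι : Type*} [Fintype ι] {n : ℕ} (ξ : ι → Fin n → Set ℝ*) : Prop :=
  ∃ t : ι → ℝ*, (∃ i, t i ≠ 0) ∧ ∃ A : Fin n → Set ℝ*,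
    (∀ j, IsNeutrix (A j)) ∧ ∀ j, (∑ i, esmul (t i) (ξ i j)) = A j

/-- The matrix has a zeroless minor of order `k`. -/
def HasZerolessMinor {m n : ℕ} (M : Matrix (Fin m) (Fin n) (Set ℝ*)) (k : ℕ) : Prop :=
  ∃ (f : Fin k → Fin m) (g : Fin k → Fin n), Function.Injective f ∧ Function.Injective g ∧
    Zeroless (detE fun i j => M (f i) (g j))

/-- The minor rank of `M` is `r`. -/
def minorRankIs {m n : ℕ} (M : Matrix (Fin m) (Fin n) (Set ℝ*)) (r : ℕ) : Prop :=
  HasZerolessMinor M r ∧ ∀ k, HasZerolessMinor M k → k ≤ r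

/-- The row rank of `M` is `r`: the maximal cardinality of a linearly
independent set of row vectors of `M` is `r`. -/
def rowRankIs {m n : ℕ} (M : Matrix (Fin m) (Fin n) (Set ℝ*)) (r : ℕ) : Prop :=
  (∃ s : Finset (Fin m), s.card = r ∧ ¬ LinDepE fun (i : {x // x ∈ s}) j => M i.1 j) ∧
  ∀ s : Finset (Fin m), (¬ LinDepE fun (i : {x // x ∈ s}) j => M i.1 j) → s.card ≤ r

/-- `M` is a reduced matrix: `max_{i,j} |α_{ij}| = 1 + A₀` for some neutrix `A₀ ⊆ ⊘`. -/
def IsReducedMat {m n : ℕ} (M : Matrix (Fin m) (Fin n) (Set ℝ*)) : Prop :=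
  ∃ A₀, IsNeutrix A₀ ∧ A₀ ⊆ oslash ∧ (∃ i j, eabs (M i j) = coset 1 A₀) ∧
    ∀ i j, ele (eabs (M i j)) (coset 1 A₀)

namespace IsNeutrix

variable {A B : Set ℝ*} {x y : ℝ*}

theorem abs_mem (hA : IsNeutrix A) (hx : x ∈ A) : |x| ∈ A := by
  rcases abs_choice x with h | h <;> rw [h]
  exacts [hx, hA.2.2.1 x hx]

theorem mem_of_abs_le (hA : IsNeutrix A) (hy : y ∈ A) (h : |x| ≤ |y|) : x ∈ A :=
  hA.2.2.2 _ (hA.2.2.1 _ (hA.abs_mem hy)) _ (hA.abs_mem hy) x (abs_le.1 h).1 (abs_le.1 h).2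

theorem sub_mem (hA : IsNeutrix A) (hx : x ∈ A) (hy : y ∈ A) : x - y ∈ A :=
  sub_eq_add_neg x y ▸ hA.2.1 x hx _ (hA.2.2.1 y hy)

theorem natCast_mul_mem (hA : IsNeutrix A) (hx : x ∈ A) (m : ℕ) : (m : ℝ*) * x ∈ A := by
  induction m with
  | zero => simpa using hA.1
  | succ m ih => simpa [add_mul] using hA.2.1 _ ih _ hx

theorem natCast_mul_abs_lt (hA : IsNeutrix A) (hx : x ∈ A) (hy : y ∉ A) (m : ℕ) :
    (m : ℝ*) * |x| < |y| := by
  by_contra! h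
  exact hy (hA.mem_of_abs_le (hA.natCast_mul_mem hx m) (by simpa [abs_mul] using h))

theorem of_abs_le_add (h0 : (0 : ℝ*) ∈ A)
    (h : ∀ x ∈ A, ∀ y ∈ A, ∀ z : ℝ*, |z| ≤ |x| + |y| → z ∈ A) : IsNeutrix A :=
  ⟨h0, fun x hx y hy => h x hx y hy _ (abs_add_le x y),
    fun x hx => h x hx 0 h0 _ (by simp),
    fun x hx y hy z hxz hzy => h x hx y hy z <| abs_le.2
      ⟨by linarith [neg_abs_le x, abs_nonneg y], by linarith [le_abs_self y, abs_nonneg x]⟩⟩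

theorem add (hA : IsNeutrix A) (hB : IsNeutrix B) : IsNeutrix (A + B) := by
  refine ⟨⟨0, hA.1, 0, hB.1, add_zero 0⟩, ?_, ?_, ?_⟩
  · rintro _ ⟨a, ha, b, hb, rfl⟩ _ ⟨a', ha', b', hb', rfl⟩
    exact ⟨a + a', hA.2.1 _ ha _ ha', b + b', hB.2.1 _ hb _ hb', add_add_add_comm _ _ _ _⟩
  · rintro _ ⟨a, ha, b, hb, rfl⟩
    exact ⟨-a, hA.2.2.1 _ ha, -b, hB.2.2.1 _ hb, (neg_add a b).symm⟩
  · rintro _ ⟨a, ha, b, hb, rfl⟩ _ ⟨a', ha', b', hb', rfl⟩ z h₁ h₂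
    rcases le_total z (a + b') with h | h
    · rcases le_total z (a' + b') with h' | h'
      · refine ⟨a, ha, z - a, hB.2.2.2 _ hb _ hb' _ ?_ ?_, add_sub_cancel a z⟩ <;>
          simp only at h₁ <;> linarith
      · exact ⟨a', ha', b', hb', le_antisymm h' h₂⟩
    · refine ⟨z - b', hA.2.2.2 _ ha _ ha' _ ?_ ?_, b', hb', sub_add_cancel z b'⟩ <;>
          simp only at h₂ <;> linarith

end IsNeutrix

section Coset

variable {a b : ℝ*} {A B : Set ℝ*}

theorem IsNeutrix.self_mem_coset (hA : IsNeutrix A) : a ∈ coset a A :=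
  ⟨0, hA.1, (add_zero a).symm⟩

theorem mem_coset_iff {x : ℝ*} : x ∈ coset a A ↔ x - a ∈ A :=
  ⟨fun ⟨u, hu, h⟩ => by simpa [h] using hu, fun h => ⟨x - a, h, by ring⟩⟩

theorem IsNeutrix.zero_mem_coset_iff (hA : IsNeutrix A) : (0 : ℝ*) ∈ coset a A ↔ a ∈ A := by
  rw [mem_coset_iff, zero_sub]
  exact ⟨fun h => by simpa using hA.2.2.1 _ h, hA.2.2.1 a⟩

theorem coset_subset_of_coset_eq (hA : IsNeutrix A) (hB : IsNeutrix B)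
    (h : coset a A = coset b B) : A ⊆ B := by
  intro x hx
  have h₁ : a + x ∈ coset b B := h ▸ ⟨x, hx, rfl⟩
  have h₂ : a ∈ coset b B := h ▸ hA.self_mem_coset
  rw [mem_coset_iff] at h₁ h₂
  simpa using hB.sub_mem h₁ h₂

theorem coset_eq_coset (hA : IsNeutrix A) (hB : IsNeutrix B) (h : coset a A = coset b B) :
    A = B ∧ b - a ∈ A :=
  ⟨(coset_subset_of_coset_eq hA hB h).antisymm (coset_subset_of_coset_eq hB hA h.symm),
    mem_coset_iff.1 (h ▸ hB.self_mem_coset)⟩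

theorem coset_add_coset : coset a A + coset b B = coset (a + b) (A + B) := by
  ext z
  constructor
  · rintro ⟨_, ⟨u, hu, rfl⟩, _, ⟨v, hv, rfl⟩, rfl⟩
    exact ⟨u + v, ⟨u, hu, v, hv, rfl⟩, add_add_add_comm _ _ _ _⟩
  · rintro ⟨_, ⟨u, hu, v, hv, rfl⟩, rfl⟩
    exact ⟨a + u, ⟨u, hu, rfl⟩, b + v, ⟨v, hv, rfl⟩, add_add_add_comm _ _ _ _⟩

end Coset

/-- The neutrix part `aB + bA + AB` of the product of `a + A` and `b + B`. -/
def mulNeutrix (a : ℝ*) (A : Set ℝ*) (b : ℝ*) (B : Set ℝ*) : Set ℝ* :=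
  {z | ∃ u ∈ A, ∃ v ∈ B, |z| ≤ |a| * |v| + |b| * |u| + |u| * |v|}

/-- The neutrix part of the product of the external numbers `a i + N i`. -/
def prodNeutrix {n : ℕ} (a : Fin n → ℝ*) (N : Fin n → Set ℝ*) : Set ℝ* :=
  {z | ∃ u : Fin n → ℝ*, (∀ i, u i ∈ N i) ∧ |z| ≤ ∏ i, (|a i| + |u i|) - ∏ i, |a i|}

section Product

variable {a b : ℝ*} {A B : Set ℝ*}

theorem IsNeutrix.mulNeutrix (hA : IsNeutrix A) (hB : IsNeutrix B) :
    IsNeutrix (mulNeutrix a A b B) := by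
  refine .of_abs_le_add ⟨0, hA.1, 0, hB.1, by simp⟩ ?_
  rintro x ⟨u, hu, v, hv, hx⟩ y ⟨u', hu', v', hv', hy⟩ z hz
  refine ⟨|u| + |u'|, hA.2.1 _ (hA.abs_mem hu) _ (hA.abs_mem hu'),
    |v| + |v'|, hB.2.1 _ (hB.abs_mem hv) _ (hB.abs_mem hv'), ?_⟩
  rw [abs_of_nonneg (by positivity : 0 ≤ |u| + |u'|),
    abs_of_nonneg (by positivity : 0 ≤ |v| + |v'|)]
  nlinarith [mul_nonneg (abs_nonneg u) (abs_nonneg v'), mul_nonneg (abs_nonneg u') (abs_nonneg v)]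

theorem mul_mem_mulNeutrix_left (hA : IsNeutrix A) {v : ℝ*} (hv : v ∈ B) :
    a * v ∈ mulNeutrix a A b B :=
  ⟨0, hA.1, v, hv, by simp [abs_mul]⟩

theorem mul_mem_mulNeutrix_right (hB : IsNeutrix B) {u : ℝ*} (hu : u ∈ A) :
    b * u ∈ mulNeutrix a A b B :=
  ⟨u, hu, 0, hB.1, by simp [abs_mul]⟩

theorem mul_mem_mulNeutrix {u v : ℝ*} (hu : u ∈ A) (hv : v ∈ B) :
    u * v ∈ mulNeutrix a A b B :=
  ⟨u, hu, v, hv, by rw [abs_mul]; exact le_add_of_nonneg_left (by positivity)⟩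

theorem exists_mem_mul_eq_mul_abs (hA : IsNeutrix A) {u t : ℝ*} (hu : u ∈ A) (ht : |t| ≤ 1) :
    ∃ v ∈ A, b * v = t * (|b| * |u|) := by
  have h : |u| * t ∈ A := hA.mem_of_abs_le hu (by
    rw [abs_mul, abs_abs]; exact mul_le_of_le_one_right (abs_nonneg u) ht)
  rcases abs_choice b with hb | hb <;> rw [hb]
  · exact ⟨_, h, by ring⟩
  · exact ⟨_, hA.2.2.1 _ h, by ring⟩

theorem emul_coset (hA : IsNeutrix A) (hB : IsNeutrix B) :
    emul (coset a A) (coset b B) = coset (a * b) (mulNeutrix a A b B) := by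
  ext z
  rw [mem_coset_iff]
  constructor
  · rintro ⟨a', A', b', B', hA', hB', ha, hb, u, hu, v, hv, u', hu', v', hv', rfl⟩
    obtain ⟨rfl, hs⟩ := coset_eq_coset hA hA' ha
    obtain ⟨rfl, ht⟩ := coset_eq_coset hB hB' hb
    have hU := IsNeutrix.mulNeutrix (a := a) (b := b) hA hB
    have key : a' * b' + a' * v + b' * u + u' * v' - a * b =
        ((a * ((b' - b) + v) + b * ((a' - a) + u)) +
          ((a' - a) * ((b' - b) + v) + u * (b' - b))) + u' * v' := by ring
    rw [key]
    have hv₁ := hB.2.1 _ ht _ hv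
    exact hU.2.1 _ (hU.2.1 _ (hU.2.1 _ (mul_mem_mulNeutrix_left hA hv₁) _
      (mul_mem_mulNeutrix_right hB (hA.2.1 _ hs _ hu))) _
      (hU.2.1 _ (mul_mem_mulNeutrix hs hv₁) _ (mul_mem_mulNeutrix hu ht))) _
      (mul_mem_mulNeutrix hu' hv')
  · rintro ⟨u, hu, v, hv, h⟩
    obtain ⟨t, ht, hz⟩ : ∃ t, |t| ≤ 1 ∧
        z - a * b = t * (|a| * |v| + |b| * |u| + |u| * |v|) := by
      rcases (by positivity : 0 ≤ |a| * |v| + |b| * |u| + |u| * |v|).eq_or_lt with h0 | h0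
      · refine ⟨0, by simp, ?_⟩
        rw [← h0] at h
        simpa using h
      · refine ⟨(z - a * b) / (|a| * |v| + |b| * |u| + |u| * |v|), ?_, (div_mul_cancel₀ _ h0.ne').symm⟩
        rwa [abs_div, abs_of_pos h0, div_le_one h0]
    obtain ⟨v₁, hv₁, e₁⟩ := exists_mem_mul_eq_mul_abs (b := a) hB hv ht
    obtain ⟨u₁, hu₁, e₂⟩ := exists_mem_mul_eq_mul_abs (b := b) hA hu ht
    obtain ⟨v₂, hv₂, e₃⟩ := exists_mem_mul_eq_mul_abs (b := u) hB hv ht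
    exact ⟨a, A, b, B, hA, hB, rfl, rfl, u₁, hu₁, v₁, hv₁, u, hu, v₂, hv₂, by
      linear_combination hz - e₁ - e₂ - e₃⟩

theorem prodNeutrix_succAbove {n : ℕ} (a : Fin (n + 1) → ℝ*) (N : Fin (n + 1) → Set ℝ*)
    (k : Fin (n + 1)) :
    prodNeutrix a N = mulNeutrix (a k) (N k) (∏ i, a (k.succAbove i))
      (prodNeutrix (fun i => a (k.succAbove i)) fun i => N (k.succAbove i)) := by
  ext z
  constructor
  · rintro ⟨u, hu, h⟩
    have hle : ∏ i, |a (k.succAbove i)| ≤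
        ∏ i, (|a (k.succAbove i)| + |u (k.succAbove i)|) :=
      Finset.prod_le_prod (fun _ _ => abs_nonneg _) fun _ _ => by simp
    refine ⟨u k, hu k, ∏ i, (|a (k.succAbove i)| + |u (k.succAbove i)|) -
      ∏ i, |a (k.succAbove i)|, ⟨_, fun i => hu _, (abs_of_nonneg (sub_nonneg.2 hle)).le⟩, ?_⟩
    rw [Fin.prod_univ_succAbove _ k, Fin.prod_univ_succAbove (fun i => |a i|) k] at h
    rw [abs_of_nonneg (sub_nonneg.2 hle), Finset.abs_prod]
    linarith
  · rintro ⟨u, hu, v, ⟨w, hw, hv⟩, h⟩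
    refine ⟨k.insertNth u w, fun i => ?_, h.trans ?_⟩
    · rcases Fin.eq_self_or_eq_succAbove k i with rfl | ⟨j, rfl⟩ <;> simp [hu, hw]
    · rw [Fin.prod_univ_succAbove _ k, Fin.prod_univ_succAbove (fun i => |a i|) k]
      simp only [Fin.insertNth_apply_same, Fin.insertNth_apply_succAbove]
      rw [Finset.abs_prod]
      nlinarith [mul_le_mul_of_nonneg_left hv (abs_nonneg (a k)),
        mul_le_mul_of_nonneg_left hv (abs_nonneg u)]

theorem eprod_coset {n : ℕ} (a : Fin n → ℝ*) {N : Fin n → Set ℝ*} (hN : ∀ i, IsNeutrix (N i)) :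
    IsNeutrix (prodNeutrix a N) ∧
      eprod (fun i => coset (a i) (N i)) = coset (∏ i, a i) (prodNeutrix a N) := by
  induction n with
  | zero =>
    have h : prodNeutrix a N = {0} := by
      ext z
      simp [prodNeutrix]
    rw [h]
    refine ⟨.of_abs_le_add rfl ?_, ?_⟩
    · rintro x rfl y rfl z hz
      simpa using hz
    · ext z
      simp [eprod, coset]
  | succ n ih =>
    obtain ⟨h₁, h₂⟩ := ih (fun i => a i.succ) fun i => hN i.succ
    have h := prodNeutrix_succAbove a N 0
    simp only [Fin.zero_succAbove] at h
    rw [h, Fin.prod_univ_succ]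
    refine ⟨(hN 0).mulNeutrix h₁, ?_⟩
    rw [← emul_coset (hN 0) h₁, ← h₂]
    rfl

theorem eprod_succAbove {n : ℕ} {f : Fin (n + 1) → Set ℝ*} (hf : ∀ i, IsExt (f i))
    (k : Fin (n + 1)) : eprod f = emul (f k) (eprod fun i => f (k.succAbove i)) := by
  choose a N hN h using hf
  obtain rfl : f = fun i => coset (a i) (N i) := funext h
  have h' := eprod_coset (fun i => a (k.succAbove i)) fun i => hN (k.succAbove i)
  rw [(eprod_coset a hN).2, h'.2, emul_coset (hN k) h'.1, prodNeutrix_succAbove a N k,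
    Fin.prod_univ_succAbove a k]

end Product

section Distributivity

variable {a b c p : ℝ*} {A B C P : Set ℝ*} {β γ ρ : Set ℝ*}

theorem mulNeutrix_subset {T : Set ℝ*} (hT : IsNeutrix T) (h₁ : ∀ v ∈ B, a * v ∈ T)
    (h₂ : ∀ u ∈ A, b * u ∈ T) (h₃ : ∀ u ∈ A, ∀ v ∈ B, u * v ∈ T) : mulNeutrix a A b B ⊆ T := by
  rintro z ⟨u, hu, v, hv, h⟩
  refine hT.mem_of_abs_le (hT.2.1 _ (hT.2.1 _ (hT.abs_mem (h₁ v hv)) _ (hT.abs_mem (h₂ u hu))) _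
    (hT.abs_mem (h₃ u hu v hv))) (h.trans ?_)
  rw [← abs_mul, ← abs_mul, ← abs_mul]
  exact le_abs_self _

theorem mulNeutrix_add_subset (hB : IsNeutrix B) (hC : IsNeutrix C) (hP : IsNeutrix P) :
    mulNeutrix (b + c) (B + C) p P ⊆ mulNeutrix b B p P + mulNeutrix c C p P := by
  refine mulNeutrix_subset ((hB.mulNeutrix hP).add (hC.mulNeutrix hP)) ?_ ?_ ?_
  · exact fun v hv => ⟨_, mul_mem_mulNeutrix_left hB hv, _, mul_mem_mulNeutrix_left hC hv,
      (add_mul _ _ _).symm⟩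
  · rintro _ ⟨u, hu, w, hw, rfl⟩
    exact ⟨_, mul_mem_mulNeutrix_right hP hu, _, mul_mem_mulNeutrix_right hP hw,
      (mul_add _ _ _).symm⟩
  · rintro _ ⟨u, hu, w, hw, rfl⟩ v hv
    exact ⟨_, mul_mem_mulNeutrix hu hv, _, mul_mem_mulNeutrix hw hv, (add_mul _ _ _).symm⟩

theorem mulNeutrix_add_eq (hB : IsNeutrix B) (hC : IsNeutrix C) (hP : IsNeutrix P)
    (h : ∀ v ∈ P, b * v ∈ mulNeutrix (b + c) (B + C) p P) :
    mulNeutrix (b + c) (B + C) p P = mulNeutrix b B p P + mulNeutrix c C p P := by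
  refine (mulNeutrix_add_subset hB hC hP).antisymm ?_
  have hT := IsNeutrix.mulNeutrix (a := b + c) (b := p) (hB.add hC) hP
  have hB' : ∀ u ∈ B, u ∈ B + C := fun u hu => ⟨u, hu, 0, hC.1, add_zero u⟩
  have hC' : ∀ u ∈ C, u ∈ B + C := fun u hu => ⟨0, hB.1, u, hu, zero_add u⟩
  rintro _ ⟨x, hx, y, hy, rfl⟩
  refine hT.2.1 _ (mulNeutrix_subset hT h ?_ ?_ hx) _ (mulNeutrix_subset hT ?_ ?_ ?_ hy)
  · exact fun u hu => mul_mem_mulNeutrix_right hP (hB' u hu)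
  · exact fun u hu v hv => mul_mem_mulNeutrix (hB' u hu) hv
  · intro v hv
    have := hT.sub_mem (mul_mem_mulNeutrix_left (hB.add hC) hv) (h v hv)
    rwa [← sub_mul, add_sub_cancel_left] at this
  · exact fun u hu => mul_mem_mulNeutrix_right hP (hC' u hu)
  · exact fun u hu v hv => mul_mem_mulNeutrix (hC' u hu) hv

theorem emul_add_subset (hβ : IsExt β) (hγ : IsExt γ) (hρ : IsExt ρ) :
    emul (β + γ) ρ ⊆ emul β ρ + emul γ ρ := by
  obtain ⟨b, B, hB, rfl⟩ := hβ
  obtain ⟨c, C, hC, rfl⟩ := hγ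
  obtain ⟨p, P, hP, rfl⟩ := hρ
  rw [coset_add_coset, emul_coset (hB.add hC) hP, emul_coset hB hP, emul_coset hC hP,
    coset_add_coset, ← add_mul]
  rintro _ ⟨u, hu, rfl⟩
  exact ⟨u, mulNeutrix_add_subset hB hC hP hu, rfl⟩

theorem emul_coset_add (hB : IsNeutrix B) (hC : IsNeutrix C) (hP : IsNeutrix P)
    (h : ∀ v ∈ P, b * v ∈ mulNeutrix (b + c) (B + C) p P) :
    emul (coset b B + coset c C) (coset p P) =
      emul (coset b B) (coset p P) + emul (coset c C) (coset p P) := by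
  rw [coset_add_coset, emul_coset (hB.add hC) hP, emul_coset hB hP, emul_coset hC hP,
    coset_add_coset, ← add_mul, mulNeutrix_add_eq hB hC hP h]

theorem emul_coset_add_of_mem (hB : IsNeutrix B) (hC : IsNeutrix C) (hP : IsNeutrix P)
    (h : b ∈ B) :
    emul (coset b B + coset c C) (coset p P) =
      emul (coset b B) (coset p P) + emul (coset c C) (coset p P) :=
  emul_coset_add hB hC hP fun _ hv => mul_mem_mulNeutrix ⟨b, h, 0, hC.1, add_zero b⟩ hv

theorem emul_coset_add_of_mul_div_mem (hB : IsNeutrix B) (hC : IsNeutrix C) (hP : IsNeutrix P)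
    (hp : p ≠ 0) (h : ∀ v ∈ P, b * (v / p) ∈ B) :
    emul (coset b B + coset c C) (coset p P) =
      emul (coset b B) (coset p P) + emul (coset c C) (coset p P) := by
  refine emul_coset_add hB hC hP fun v hv => ?_
  have hm : b * (v / p) ∈ B + C := ⟨_, h v hv, 0, hC.1, add_zero _⟩
  have := mul_mem_mulNeutrix_right (a := b + c) (b := p) hP hm
  rwa [mul_left_comm, mul_div_cancel₀ v hp] at this

theorem emul_coset_add_of_abs_le (hB : IsNeutrix B) (hC : IsNeutrix C) (hP : IsNeutrix P)
    {m : ℕ} (h : |b| ≤ m * |b + c|) :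
    emul (coset b B + coset c C) (coset p P) =
      emul (coset b B) (coset p P) + emul (coset c C) (coset p P) := by
  refine emul_coset_add hB hC hP fun v hv => ?_
  refine ((hB.add hC).mulNeutrix hP).mem_of_abs_le
    (mul_mem_mulNeutrix_left (hB.add hC) (hP.natCast_mul_mem hv m)) ?_
  rw [abs_mul, abs_mul, abs_mul, Nat.abs_cast]
  nlinarith [mul_le_mul_of_nonneg_right h (abs_nonneg v)]

end Distributivity

section NearlyOpposite

open Hyperreal

variable {b c : ℝ*} {B C : Set ℝ*}

set_option linter.deprecated false

theorem isSt_div_of_natCast_mul_abs_lt {u : ℝ*} (h : ∀ m : ℕ, (m : ℝ*) * |u| < |b|) :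
    IsSt (u / b) 0 := by
  rw [isSt_iff_abs_sub_lt_delta]
  intro δ hδ
  obtain ⟨m, hm⟩ := exists_nat_gt δ⁻¹
  have hb : 0 < |b| := by simpa using h 0
  have hm' : (1 : ℝ*) < m * (δ : ℝ*) := by
    have : 1 < (m : ℝ) * δ := by rwa [inv_lt_iff_one_lt_mul₀ hδ] at hm
    rw [show (m : ℝ*) = ((m : ℝ) : ℝ*) from rfl, ← coe_mul, ← coe_one]
    exact coe_lt_coe.2 this
  have hδ' : (0 : ℝ*) < δ := by exact_mod_cast hδ
  rw [coe_zero, sub_zero, abs_div, div_lt_iff₀ hb]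
  nlinarith [h m, abs_nonneg u]

theorem IsNeutrix.isSt_div (hB : IsNeutrix B) (hb : b ∉ B) {u : ℝ*} (hu : u ∈ B) :
    IsSt (u / b) 0 :=
  isSt_div_of_natCast_mul_abs_lt (hB.natCast_mul_abs_lt hu hb)

theorem IsNeutrix.isSt_div_of_mem_coset (hB : IsNeutrix B) (hb : b ∉ B) {x : ℝ*}
    (hx : x ∈ coset b B) : IsSt (x / b) 1 := by
  obtain ⟨u, hu, rfl⟩ := hx
  have hb0 : b ≠ 0 := fun h => hb (h ▸ hB.1)
  have := (isSt_refl_real 1).add (hB.isSt_div hb hu)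
  rwa [add_zero, coe_one, ← div_self hb0, ← add_div] at this

theorem isSt_inv_one {x : ℝ*} (hx : IsSt x 1) : IsSt x⁻¹ 1 := by
  have := hx.map (f := fun r => r⁻¹) (continuousAt_inv₀ one_ne_zero)
  rw [inv_one] at this
  exact this

theorem isSt_mul_of_mem_einv (hC : IsNeutrix C) (hc : c ∉ C) {e : ℝ*}
    (he : e ∈ einv (coset c C)) : IsSt (e * c) 1 := by
  obtain ⟨c', C', hC', h, u, hu, rfl⟩ := he
  obtain ⟨rfl, hs⟩ := coset_eq_coset hC hC' h
  have hc0 : c ≠ 0 := fun h => hc (h ▸ hC.1)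
  have hc' : c' ∉ C := fun h' => hc (by simpa using hC.sub_mem h' hs)
  have hc0' : c' ≠ 0 := fun h => hc' (h ▸ hC.1)
  have h₁ := hC.isSt_div_of_mem_coset hc' (h ▸ hC.self_mem_coset (a := c))
  have h₂ := h₁.add ((hC.isSt_div hc' hu).mul h₁)
  convert h₂ using 1
  · field_simp
  · norm_num

theorem nearlyOpposite_coset (hB : IsNeutrix B) (hC : IsNeutrix C) (hb : b ∉ B) (hc : c ∉ C)
    (h : ∀ m : ℕ, (m : ℝ*) * |b + c| < |b|) : NearlyOpposite (coset b B) (coset c C) := by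
  refine ⟨mt hB.zero_mem_coset_iff.1 hb, mt hC.zero_mem_coset_iff.1 hc, ?_⟩
  rintro z ⟨a', A', e, E, hA', hE, hβ, hγ, u, hu, v, hv, u', hu', v', hv', rfl⟩
  obtain ⟨rfl, hs⟩ := coset_eq_coset hB hA' hβ
  have hb0 : b ≠ 0 := fun h => hb (h ▸ hB.1)
  have hc0 : c ≠ 0 := fun h => hc (h ▸ hC.1)
  have hcb : IsSt (c / b) (-1) := by
    have := (isSt_div_of_natCast_mul_abs_lt h).sub (isSt_refl_real 1)
    rw [coe_one, add_div, div_self hb0, add_sub_cancel_left, zero_sub] at this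
    exact this
  have hbc : IsSt (b / c) (-1) := by
    have := (isSt_inv_one (by simpa using hcb.neg)).neg
    rwa [inv_neg, neg_neg, inv_div] at this
  have ha : IsSt (a' / b) 1 :=
    hB.isSt_div_of_mem_coset hb (hβ ▸ hA'.self_mem_coset)
  have he : ∀ w ∈ E, IsSt ((e + w) * c) 1 := fun w hw =>
    isSt_mul_of_mem_einv hC hc (hγ ▸ ⟨w, hw, rfl⟩)
  have he₀ : IsSt (e * c) 1 := by simpa using he 0 hE.1
  have hE' : ∀ w ∈ E, IsSt (w * c) 0 := fun w hw => by
    simpa [add_mul] using (he w hw).sub he₀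
  have key := (((ha.mul he₀).add (ha.mul (hE' v hv))).add
    (he₀.mul (hB.isSt_div hb hu))).add ((hB.isSt_div hb hu').mul (hE' v' hv'))
  rw [mem_coset_iff]
  have := (hbc.mul key).add (isSt_refl_real 1)
  change IsSt _ 0
  convert this using 1
  · rw [coe_one]
    field_simp
    ring
  · norm_num

end NearlyOpposite

section RelativeUncertainty

variable {b : ℝ*} {B : Set ℝ*} {α : Set ℝ*}

theorem mul_mem_of_mem_RU (hB : IsNeutrix B) (hb : b ∉ B) {r : ℝ*}
    (hr : r ∈ RU (coset b B)) : b * r ∈ B := by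
  rw [RU, if_neg (mt hB.zero_mem_coset_iff.1 hb)] at hr
  obtain ⟨b', B', hB', h, u, hu, rfl⟩ := hr
  obtain ⟨rfl, hs⟩ := coset_eq_coset hB hB' h
  have hb' : b' ∉ B := fun h' => hb (by simpa using hB.sub_mem h' hs)
  have h₁ := hB.natCast_mul_abs_lt hs hb' 2
  have h₂ : |b| ≤ |b'| + |b' - b| := by
    simpa [abs_sub_comm] using abs_sub b' (b' - b)
  have hpos : 0 < |b'| := by simpa using hB.natCast_mul_abs_lt hs hb' 0
  refine hB.mem_of_abs_le (hB.natCast_mul_mem hu 2) ?_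
  rw [abs_mul, abs_div, abs_mul, Nat.abs_cast, ← mul_div_assoc, div_le_iff₀ hpos]
  push_cast at h₁ ⊢
  nlinarith [abs_nonneg u]

theorem exists_coset_of_RU_subset (hα : IsExt α) (hB : IsNeutrix B) (hb : b ∉ B)
    (h : RU α ⊆ RU (coset b B)) :
    ∃ a A, IsNeutrix A ∧ α = coset a A ∧ a ≠ 0 ∧ ∀ u ∈ A, b * (u / a) ∈ B := by
  obtain ⟨a, A, hA, rfl⟩ := hα
  have h0 : (0 : ℝ*) ∉ coset a A := fun h0 => hb <| by
    have : (1 : ℝ*) ∈ RU (coset a A) := by simp [RU, h0]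
    simpa using mul_mem_of_mem_RU hB hb (h this)
  refine ⟨a, A, hA, rfl, ?_, fun u hu => mul_mem_of_mem_RU hB hb (h ?_)⟩
  · rintro rfl
    exact h0 hA.self_mem_coset
  · rw [RU, if_neg h0]
    exact ⟨a, A, hA, rfl, u, hu, rfl⟩

theorem mul_prod_one_add_sub_one_mem (hB : IsNeutrix B) (hb : b ∉ B) {ι : Type*} (s : Finset ι)
    {r : ι → ℝ*} (hr : ∀ i, b * r i ∈ B) : b * (∏ i ∈ s, (1 + r i) - 1) ∈ B := by
  induction s using Finset.cons_induction with
  | empty => simpa using hB.1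
  | cons i s hi ih =>
    rw [Finset.prod_cons]
    have h : b * (r i * (∏ i ∈ s, (1 + r i) - 1)) ∈ B := by
      have h₁ := hB.natCast_mul_abs_lt (hr i) hb 1
      have hb0 : 0 < |b| := by simpa using hB.natCast_mul_abs_lt hB.1 hb 0
      rw [Nat.cast_one, one_mul, abs_mul, mul_lt_iff_lt_one_right hb0] at h₁
      refine hB.mem_of_abs_le ih ?_
      rw [mul_left_comm, abs_mul]
      exact mul_le_of_le_one_left (abs_nonneg _) h₁.le
    convert hB.2.1 _ (hB.2.1 _ (hr i) _ ih) _ h using 1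
    ring

theorem mul_div_prod_mem (hB : IsNeutrix B) (hb : b ∉ B) {n : ℕ} {a : Fin n → ℝ*}
    {N : Fin n → Set ℝ*} (ha : ∀ i, a i ≠ 0) (h : ∀ i, ∀ u ∈ N i, b * (u / a i) ∈ B) {v : ℝ*}
    (hv : v ∈ prodNeutrix a N) : b * (v / ∏ i, a i) ∈ B := by
  obtain ⟨u, hu, hv⟩ := hv
  have hr : ∀ i, b * |u i / a i| ∈ B := fun i =>
    hB.mem_of_abs_le (h i _ (hu i)) (by simp [abs_mul])
  refine hB.mem_of_abs_le (mul_prod_one_add_sub_one_mem hB hb Finset.univ hr) ?_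
  have hp : 0 < |∏ i, a i| := abs_pos.2 (Finset.prod_ne_zero_iff.2 fun i _ => ha i)
  have hprod : ∏ i, (|a i| + |u i|) = |∏ i, a i| * ∏ i, (1 + |u i / a i|) := by
    rw [Finset.abs_prod, ← Finset.prod_mul_distrib]
    refine Finset.prod_congr rfl fun i _ => ?_
    have := abs_pos.2 (ha i)
    rw [abs_div]
    field_simp
  rw [abs_mul, abs_mul, abs_div]
  refine mul_le_mul_of_nonneg_left ?_ (abs_nonneg b)
  rw [div_le_iff₀ hp]
  rw [hprod, ← Finset.abs_prod] at hv
  nlinarith [le_abs_self (∏ i, (1 + |u i / a i|) - 1)]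

end RelativeUncertainty

section Determinant

variable {β γ : Set ℝ*}

theorem isExt_eprod {n : ℕ} {f : Fin n → Set ℝ*} (hf : ∀ i, IsExt (f i)) : IsExt (eprod f) := by
  choose a N hN h using hf
  obtain rfl : f = fun i => coset (a i) (N i) := funext h
  exact ⟨_, _, eprod_coset a hN⟩

theorem emul_add_eprod_of_RU_subset (hβ : IsExt β) (hγ : IsExt γ) {n : ℕ}
    {f : Fin n → Set ℝ*} (hf : ∀ i, IsExt (f i)) (h : ∀ i, RU (f i) ⊆ RU β) :
    emul (β + γ) (eprod f) = emul β (eprod f) + emul γ (eprod f) := by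
  obtain ⟨b, B, hB, rfl⟩ := hβ
  obtain ⟨c, C, hC, rfl⟩ := hγ
  by_cases hb : b ∈ B
  · obtain ⟨p, P, hP, hp⟩ := isExt_eprod hf
    rw [hp]
    exact emul_coset_add_of_mem hB hC hP hb
  · choose a N hN hfa ha hr using fun i => exists_coset_of_RU_subset (hf i) hB hb (h i)
    obtain rfl : f = fun i => coset (a i) (N i) := funext hfa
    obtain ⟨hP, hp⟩ := eprod_coset a hN
    rw [hp]
    exact emul_coset_add_of_mul_div_mem hB hC hP (Finset.prod_ne_zero_iff.2 fun i _ => ha i)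
      fun v hv => mul_div_prod_mem hB hb ha hr hv

theorem emul_add_of_not_nearlyOpposite (hβ : IsExt β) (hγ : IsExt γ) {ρ : Set ℝ*}
    (hρ : IsExt ρ) (h : ¬ NearlyOpposite β γ) :
    emul (β + γ) ρ = emul β ρ + emul γ ρ := by
  obtain ⟨b, B, hB, rfl⟩ := hβ
  obtain ⟨c, C, hC, rfl⟩ := hγ
  obtain ⟨p, P, hP, rfl⟩ := hρ
  by_cases hb : b ∈ B
  · exact emul_coset_add_of_mem hB hC hP hb
  by_cases hc : c ∈ C
  · rw [add_comm, emul_coset_add_of_mem hC hB hP hc, add_comm]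
  obtain ⟨m, hm⟩ := not_forall.1 (mt (nearlyOpposite_coset hB hC hb hc) h)
  exact emul_coset_add_of_abs_le hB hC hP (not_lt.1 hm)

theorem esmul_add (t : ℝ*) (α β : Set ℝ*) : esmul t (α + β) = esmul t α + esmul t β :=
  smul_add t α β

theorem eprod_row_succAbove {n : ℕ} {M : Matrix (Fin (n + 1)) (Fin (n + 1)) (Set ℝ*)}
    (hM : ∀ i j, IsExt (M i j)) (k : Fin (n + 1)) (σ : Equiv.Perm (Fin (n + 1))) :
    eprod (fun i => M i (σ i)) =
      emul (M k (σ k)) (eprod fun i => M (k.succAbove i) (σ (k.succAbove i))) :=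
  eprod_succAbove (fun _ => hM _ _) k

end Determinant

theorem stmt8 {n : ℕ} (B C A : Matrix (Fin n) (Fin n) (Set ℝ*)) (k : Fin n)
    (hB : ∀ i j, IsExt (B i j)) (hC : ∀ i j, IsExt (C i j))
    (hrow : ∀ i j, i ≠ k → B i j = C i j)
    (hAoff : ∀ i j, i ≠ k → A i j = B i j)
    (hAk : ∀ j, A k j = B k j + C k j) :
    detE A ⊆ detE B + detE C ∧
      (((∀ i, i ≠ k → ∀ j j', RU (A i j) ⊆ RU (B k j')) ∨
        (∀ i, i ≠ k → ∀ j j', RU (A i j) ⊆ RU (C k j')) ∨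
        ∀ j, ¬ NearlyOpposite (B k j) (C k j)) →
        detE A = detE B + detE C) := by
  obtain _ | n := n
  · exact k.elim0
  have hA : ∀ i j, IsExt (A i j) := by
    intro i j
    by_cases hi : i = k
    · obtain ⟨b, β, hβ, hb⟩ := hB k j
      obtain ⟨c, γ, hγ, hc⟩ := hC k j
      exact ⟨b + c, β + γ, hβ.add hγ, by rw [hi, hAk, hb, hc, coset_add_coset]⟩
    · exact hAoff i j hi ▸ hB i j
  have hAB : ∀ i j, A (k.succAbove i) j = B (k.succAbove i) j := fun i j =>
    hAoff _ j (k.succAbove_ne i)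
  have hCB : ∀ i j, C (k.succAbove i) j = B (k.succAbove i) j := fun i j =>
    (hrow _ j (k.succAbove_ne i)).symm
  unfold detE
  simp only [eprod_row_succAbove hA k, eprod_row_succAbove hB k, eprod_row_succAbove hC k,
    hAB, hCB, hAk, ← Finset.sum_add_distrib, ← esmul_add]
  have hP : ∀ σ : Equiv.Perm (Fin (n + 1)),
      IsExt (eprod fun i => B (k.succAbove i) (σ (k.succAbove i))) := fun σ =>
    isExt_eprod fun i => hB _ _
  refine ⟨Set.finsetSum_subset_finsetSum _ _ _ fun σ _ => Set.image_mono
    (emul_add_subset (hB _ _) (hC _ _) (hP σ)), fun h => Finset.sum_congr rfl fun σ _ => ?_⟩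
  congr 1
  obtain h | h | h := h
  · exact emul_add_eprod_of_RU_subset (hB _ _) (hC _ _) (fun i => hB _ _) fun i =>
      hAB i _ ▸ h _ (k.succAbove_ne i) _ _
  · rw [add_comm, emul_add_eprod_of_RU_subset (hC _ _) (hB _ _) (fun i => hB _ _) fun i =>
      hAB i _ ▸ h _ (k.succAbove_ne i) _ _, add_comm]
  · exact emul_add_of_not_nearlyOpposite (hB _ _) (hC _ _) (hP σ) (h _)
end
end

section
/- Let A be a 2×2 matrix over 𝔼 that is invertible with respect to some neutrix N ⊆ ⊘, i.e. there exists a 2×2 matrix B over 𝔼 with AB ⊆ I₂(N) and BA ⊆ I₂(N). Then A is non-singular: det(A) is zeroless. -/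
open scoped Pointwise Classical

noncomputable section

theorem IsNeutrix.mem_of_abs_le_s13 {A : Set ℝ*} (hA : IsNeutrix A) {x y : ℝ*} (hy : y ∈ A)
    (h : |x| ≤ |y|) : x ∈ A := by
  obtain ⟨-, -, hneg, hconv⟩ := hA
  have habs : |y| ∈ A := by
    rcases abs_choice y with h | h <;> rw [h]
    exacts [hy, hneg y hy]
  exact hconv _ (hneg _ habs) _ habs x (abs_le.mp h).1 (abs_le.mp h).2

theorem IsNeutrix.abs_lt_of_notMem {A : Set ℝ*} (hA : IsNeutrix A) {a u : ℝ*} (ha : a ∉ A)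
    (hu : u ∈ A) : |u| < |a| :=
  lt_of_not_ge fun h => ha (hA.mem_of_abs_le_s13 hu h)

theorem IsNeutrix.mul_div_mem {A : Set ℝ*} (hA : IsNeutrix A) {a u v : ℝ*} (hv : v ∈ A)
    (h : |u| ≤ |a|) : u * v / a ∈ A := by
  refine hA.mem_of_abs_le_s13 hv ?_
  rw [mul_div_right_comm, abs_mul, abs_div]
  exact mul_le_of_le_one_left (abs_nonneg v) (div_le_one_of_le₀ h (abs_nonneg a))

theorem IsNeutrix.exists_mul_eq_add {A B : Set ℝ*} (hB : IsNeutrix B)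
    {x x' y y' : ℝ*} (hx : x ∈ A) (hx' : x' ∈ A) (hy : y ∈ B) (hy' : y' ∈ B) :
    ∃ p ∈ A, ∃ q ∈ B, x * y + x' * y' = p * q := by
  wlog h : |x| ≤ |x'| generalizing x x' y y'
  · obtain ⟨p, hp, q, hq, e⟩ := this hx' hx hy' hy (le_of_not_ge h)
    exact ⟨p, hp, q, hq, by rw [add_comm, e]⟩
  by_cases h0 : x' = 0
  · have hx0 : x = 0 := by simpa [h0] using h
    exact ⟨x', hx', y', hy', by simp [hx0]⟩
  · refine ⟨x', hx', y' + x * y / x', hB.2.1 _ hy' _ (hB.mul_div_mem hy h), ?_⟩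
    field_simp
    ring

theorem exists_mul_eq_of_notMem {A B : Set ℝ*} (hA : IsNeutrix A) (hB : IsNeutrix B)
    {a b u v u' v' : ℝ*} (ha : a ∉ A) (hu : u ∈ A) (hv : v ∈ B) (hu' : u' ∈ A) (hv' : v' ∈ B) :
    ∃ x ∈ coset a A, ∃ y ∈ coset b B, a * b + a * v + b * u + u' * v' = x * y := by
  have ha0 : a ≠ 0 := fun h => ha (h ▸ hA.1)
  set w := v + u' * v' / a with hw
  have hwB : w ∈ B := hB.2.1 _ hv _ (hB.mul_div_mem hv' (hA.abs_lt_of_notMem ha hu').le)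
  have hz : a * b + a * v + b * u + u' * v' = a * (b + w) + b * u := by
    rw [hw]
    field_simp
    ring
  rw [hz]
  by_cases hbu : b * u / a ∈ B
  · refine ⟨a, ⟨0, hA.1, by simp⟩, b + (w + b * u / a), ⟨_, hB.2.1 _ hwB _ hbu, rfl⟩, ?_⟩
    field_simp
    ring
  · have hb0 : b ≠ 0 := by
      rintro rfl
      exact hbu (by simpa using hB.1)
    have hlt := hB.abs_lt_of_notMem hbu hwB
    have hmem : a * w / b ∈ A := by
      refine hA.mem_of_abs_le_s13 hu ?_
      rw [abs_div, abs_mul, lt_div_iff₀ (abs_pos.mpr ha0)] at hlt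
      rw [abs_div, abs_mul, div_le_iff₀ (abs_pos.mpr hb0)]
      linarith
    refine ⟨a + (u + a * w / b), ⟨_, hA.2.1 _ hu _ hmem, rfl⟩, b, ⟨0, hB.1, by simp⟩, ?_⟩
    field_simp
    ring

theorem IsNeutrix.coset_eq_self {A : Set ℝ*} (hA : IsNeutrix A) {a : ℝ*} (ha : a ∈ A) :
    coset a A = A := by
  ext x
  constructor
  · rintro ⟨u, hu, rfl⟩
    exact hA.2.1 _ ha _ hu
  · exact fun hx => ⟨-a + x, hA.2.1 _ (hA.2.2.1 _ ha) _ hx, by ring⟩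

theorem exists_mul_eq_of_mem_emul {α β : Set ℝ*} {z : ℝ*} (hz : z ∈ emul α β) :
    ∃ x ∈ α, ∃ y ∈ β, z = x * y := by
  obtain ⟨a, A, b, B, hA, hB, rfl, rfl, u, hu, v, hv, u', hu', v', hv', rfl⟩ := hz
  by_cases ha : a ∈ A
  · by_cases hb : b ∈ B
    · rw [hA.coset_eq_self ha, hB.coset_eq_self hb]
      obtain ⟨p, hp, q, hq, e⟩ := hB.exists_mul_eq_add ha hu (hB.2.1 _ hb _ hv) hb
      obtain ⟨p', hp', q', hq', e'⟩ := hB.exists_mul_eq_add hp hu' hq hv'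
      exact ⟨p', hp', q', hq', by rw [← e', ← e]; ring⟩
    · obtain ⟨y, hy, x, hx, e⟩ := exists_mul_eq_of_notMem hB hA (b := a) hb hv hu hv' hu'
      exact ⟨x, hx, y, hy, by rw [mul_comm x, ← e]; ring⟩
  · exact exists_mul_eq_of_notMem hA hB ha hu hv hu' hv'

theorem mul_mem_emul {α β : Set ℝ*} (hα : IsExt α) (hβ : IsExt β) {x y : ℝ*}
    (hx : x ∈ α) (hy : y ∈ β) : x * y ∈ emul α β := by
  obtain ⟨a, A, hA, rfl⟩ := hα
  obtain ⟨b, B, hB, rfl⟩ := hβ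
  obtain ⟨u, hu, rfl⟩ := hx
  obtain ⟨v, hv, rfl⟩ := hy
  exact ⟨a, A, b, B, hA, hB, rfl, rfl, u, hu, v, hv, u, hu, v, hv, by ring⟩

theorem IsExt.nonempty {α : Set ℝ*} (hα : IsExt α) : α.Nonempty := by
  obtain ⟨a, A, hA, rfl⟩ := hα
  exact ⟨a, 0, hA.1, by simp⟩

theorem mul_apply_mem_matMul {m n p : ℕ} {A : Matrix (Fin m) (Fin n) (Set ℝ*)}
    {B : Matrix (Fin n) (Fin p) (Set ℝ*)} (hA : ∀ i j, IsExt (A i j)) (hB : ∀ i j, IsExt (B i j))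
    {P : Matrix (Fin m) (Fin n) ℝ*} {Q : Matrix (Fin n) (Fin p) ℝ*}
    (hP : ∀ i j, P i j ∈ A i j) (hQ : ∀ i j, Q i j ∈ B i j) (i : Fin m) (j : Fin p) :
    (P * Q) i j ∈ matMul A B i j := by
  rw [Matrix.mul_apply]
  exact Set.finsetSum_mem_finsetSum _ _ _ fun k _ =>
    mul_mem_emul (hA i k) (hB k j) (hP i k) (hQ k j)

theorem exists_det_eq_of_mem_detE {A : Matrix (Fin 2) (Fin 2) (Set ℝ*)} {z : ℝ*}
    (hz : z ∈ detE A) :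
    ∃ P : Matrix (Fin 2) (Fin 2) ℝ*, (∀ i j, P i j ∈ A i j) ∧ P.det = z := by
  have hprod : ∀ {f : Fin 2 → Set ℝ*} {x : ℝ*}, x ∈ eprod f →
      ∃ p ∈ f 0, ∃ q ∈ f 1, x = p * q := by
    intro f x hx
    obtain ⟨p, hp, y, hy, rfl⟩ := exists_mul_eq_of_mem_emul hx
    obtain ⟨q, hq, w, rfl, rfl⟩ := exists_mul_eq_of_mem_emul hy
    exact ⟨p, hp, q, hq, by ring⟩
  have huniv : (Finset.univ : Finset (Equiv.Perm (Fin 2))) = {1, Equiv.swap 0 1} := by decide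
  have hne : (1 : Equiv.Perm (Fin 2)) ≠ Equiv.swap 0 1 := by decide
  rw [detE, huniv, Finset.sum_pair hne, Set.mem_add] at hz
  obtain ⟨_, ⟨x, hx, rfl⟩, _, ⟨y, hy, rfl⟩, rfl⟩ := hz
  obtain ⟨p, hp, q, hq, rfl⟩ := hprod hx
  obtain ⟨r, hr, s, hs, rfl⟩ := hprod hy
  refine ⟨!![p, r; s, q], ?_, ?_⟩
  · intro i j
    fin_cases i <;> fin_cases j <;> simp_all
  · simp [Matrix.det_fin_two, sub_eq_add_neg]

theorem det_ne_zero_of_mem_Iun {N : Set ℝ*} (hNo : N ⊆ oslash) {M : Matrix (Fin 2) (Fin 2) ℝ*}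
    (hM : ∀ i j, M i j ∈ Iun 2 N i j) : M.det ≠ 0 := by
  have hsmall : ∀ e ∈ N, |e| < 1 / 3 := by
    intro e he
    have := hNo he (1 / 3) (by norm_num)
    norm_num [abs_lt] at this ⊢
    exact this
  obtain ⟨e, he, h00⟩ : M 0 0 ∈ coset 1 N := by simpa [Iun] using hM 0 0
  obtain ⟨f, hf, h11⟩ : M 1 1 ∈ coset 1 N := by simpa [Iun] using hM 1 1
  have h01 : M 0 1 ∈ N := by simpa [Iun] using hM 0 1
  have h10 : M 1 0 ∈ N := by simpa [Iun] using hM 1 0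
  have hoff : |M 0 1 * M 1 0| ≤ 1 / 3 * (1 / 3) := by
    rw [abs_mul]
    exact mul_le_mul (hsmall _ h01).le (hsmall _ h10).le (abs_nonneg _) (by norm_num)
  have he' := abs_lt.mp (hsmall e he)
  have hf' := abs_lt.mp (hsmall f hf)
  rw [Matrix.det_fin_two, h00, h11]
  have := le_abs_self (M 0 1 * M 1 0)
  apply ne_of_gt
  nlinarith

theorem stmt13 (A : Matrix (Fin 2) (Fin 2) (Set ℝ*)) (hA : ∀ i j, IsExt (A i j))
    (N : Set ℝ*) (hN : IsNeutrix N) (hNo : N ⊆ oslash)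
    (B : Matrix (Fin 2) (Fin 2) (Set ℝ*)) (hB : ∀ i j, IsExt (B i j))
    (h1 : matIncl (matMul A B) (Iun 2 N)) (h2 : matIncl (matMul B A) (Iun 2 N)) :
    Zeroless (detE A) := by
  intro h0
  obtain ⟨P, hP, hdet⟩ := exists_det_eq_of_mem_detE h0
  choose Q hQ using fun i j => (hB i j).nonempty
  refine det_ne_zero_of_mem_Iun hNo
    (fun i j => h1 i j (mul_apply_mem_matMul hA hB hP (Q := Matrix.of Q) hQ i j)) ?_
  rw [Matrix.det_mul, hdet, zero_mul]
end
end
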